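/- Let (X, d) be a complete metric space, let α, β, γ, δ, ε, ζ : X×X → ℝ, and let T : X → X be an (α, β, γ, δ, ε, ζ)-weighted generalized pseudocontraction. Suppose there exists λ : X×X → [0,1] such that for all x, y ∈ X: α_λ(x,y) + ε_λ(x,y) + 2·min{γ_λ(x,y), 0} > 0 and δ_λ(x,y) + ζ_λ(x,y) + 2·min{γ_λ(x,y), 0} ≥ 0. Then for every x ∈ X the sequence (Tⁿx)_{n∈ℕ} converges to a point of X. -/

import Mathlib

open Filter Topology

/-- `T` is an `(α, β, γ, δ, ε, ζ)`-weighted generalized pseudocontraction. -/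
def IsWGPseudocontraction {X : Type*} [MetricSpace X]
    (T : X → X) (α β γ δ ε ζ : X → X → ℝ) : Prop :=
  ∀ x y : X,
    α x y * dist (T x) (T y) ^ 2 + β x y * dist x (T y) ^ 2 +
      γ x y * dist (T x) y ^ 2 + δ x y * dist x y ^ 2 +
      ε x y * dist x (T x) ^ 2 + ζ x y * dist y (T y) ^ 2 ≤ 0

/-- The `l`-weighted combination of two coefficient maps:
`(f, g) ↦ (x, y) ↦ (1 − l(x,y))·f(x,y) + l(x,y)·g(y,x)`.
With it: `α_λ = wComb l α α`, `β_λ = wComb l β γ`, `γ_λ = wComb l γ β`,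
`δ_λ = wComb l δ δ`, `ε_λ = wComb l ε ζ`, `ζ_λ = wComb l ζ ε`. -/
def wComb {X : Type*} (l f g : X → X → ℝ) : X → X → ℝ :=
  fun x y => (1 - l x y) * f x y + l x y * g y x

/-- A convex combination of the defining inequality at `(x, y)` and at `(y, x)`. -/
theorem IsWGPseudocontraction.wComb {X : Type*} [MetricSpace X] {T : X → X}
    {α β γ δ ε ζ l : X → X → ℝ} (hT : IsWGPseudocontraction T α β γ δ ε ζ)
    (hl : ∀ x y, l x y ∈ Set.Icc (0 : ℝ) 1) :
    IsWGPseudocontraction T (wComb l α α) (wComb l β γ) (wComb l γ β) (wComb l δ δ)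
      (wComb l ε ζ) (wComb l ζ ε) := by
  intro x y
  have hxy := mul_nonpos_of_nonneg_of_nonpos (sub_nonneg.2 (hl x y).2) (hT x y)
  have hyx := mul_nonpos_of_nonneg_of_nonpos (hl x y).1 (hT y x)
  rw [dist_comm (T y) (T x), dist_comm y (T x), dist_comm (T y) x, dist_comm y x] at hyx
  unfold _root_.wComb
  linarith

/-- Under the coefficient conditions, `T` maps every point to a fixed point. -/
theorem IsWGPseudocontraction.map_map_eq {X : Type*} [MetricSpace X] {T : X → X}
    {α β γ δ ε ζ : X → X → ℝ} (hT : IsWGPseudocontraction T α β γ δ ε ζ)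
    (hpos : ∀ x y, 0 < α x y + ε x y + 2 * min (γ x y) 0)
    (hnonneg : ∀ x y, 0 ≤ δ x y + ζ x y + 2 * min (γ x y) 0) (x : X) :
    T (T x) = T x := by
  have h := hT (T x) x
  have hp := hpos (T x) x
  have hn := mul_nonneg (hnonneg (T x) x) (sq_nonneg (dist x (T x)))
  rw [dist_self, dist_comm (T x) (T (T x)), dist_comm (T x) x] at h
  have htri := dist_triangle (T (T x)) (T x) x
  rw [dist_comm (T x) x] at htri
  have hsq : dist (T (T x)) x ^ 2 ≤ 2 * dist (T (T x)) (T x) ^ 2 + 2 * dist x (T x) ^ 2 := by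
    nlinarith [sq_nonneg (dist (T (T x)) (T x) - dist x (T x)),
      pow_le_pow_left₀ dist_nonneg htri 2]
  have hmin := mul_le_mul_of_nonpos_left hsq (min_le_right (γ (T x) x) 0)
  have hγ := mul_le_mul_of_nonneg_right (min_le_left (γ (T x) x) 0)
    (sq_nonneg (dist (T (T x)) x))
  by_contra hne
  have ha := mul_pos hp (pow_pos (dist_pos.2 hne) 2)
  linarith

theorem stmt_10 {X : Type*} [MetricSpace X] [CompleteSpace X]
    (α β γ δ ε ζ : X → X → ℝ)
    (T : X → X) (hT : IsWGPseudocontraction T α β γ δ ε ζ)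
    (h : ∃ l : X → X → ℝ, (∀ x y : X, l x y ∈ Set.Icc (0 : ℝ) 1) ∧
      ∀ x y : X,
        0 < wComb l α α x y + wComb l ε ζ x y + 2 * min (wComb l γ β x y) 0 ∧
        0 ≤ wComb l δ δ x y + wComb l ζ ε x y + 2 * min (wComb l γ β x y) 0) :
    ∀ x : X, ∃ u : X, Tendsto (fun n : ℕ => T^[n] x) atTop (𝓝 u) := by
  intro x
  obtain ⟨l, hl, h⟩ := h
  have hfix : T (T x) = T x :=
    (hT.wComb hl).map_map_eq (fun x y => (h x y).1) (fun x y => (h x y).2) x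
  refine ⟨T x, tendsto_const_nhds.congr' ?_⟩
  filter_upwards [eventually_ge_atTop 1] with n hn
  obtain ⟨m, rfl⟩ := Nat.exists_eq_add_of_le' hn
  rw [Function.iterate_succ_apply, Function.iterate_fixed hfix]
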